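/- arXiv:2407.03101 — 2 statements merged into one kernel-verified Lean document; each statement's English description precedes it below -/
import Mathlib

section
/- Let P and Q be polygonal curves in ℝ^d. If there exists a directed path from s to t in the VE graph G_VE(P,Q) whose maximum vertex height equals d_VE(P,Q) and whose sequence of vertex locations is monotone (both coordinates nondecreasing along the path), then d_F(P,Q) = d_VE(P,Q); that is, a monotone optimal VE morphing realizes the Fréchet distance between the curves. -/
open Set

/-- The vertices of a polygonal curve, extended to an `ℕ`-indexed family by clamping. -/
def pext {d n : ℕ} (p : Fin (n + 1) → EuclideanSpace ℝ (Fin d)) :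
    ℕ → EuclideanSpace ℝ (Fin d) :=
  fun j => p ⟨min j n, Nat.lt_succ_of_le (min_le_right _ _)⟩

/-- `cum p i` is the arc length of the polygonal curve `p` up to its `i`-th vertex;
`cum p n` is its total length. -/
noncomputable def cum {d n : ℕ} (p : Fin (n + 1) → EuclideanSpace ℝ (Fin d)) (i : ℕ) : ℝ :=
  ∑ j ∈ Finset.range (min i n), dist (pext p j) (pext p (j + 1))

/-- `A : [0, cum p n] → ℝ^d` is the uniform (arc-length) parameterization of the polygonal
curve with vertices `p 0, …, p n`. -/
def IsArcParam {d n : ℕ} (p : Fin (n + 1) → EuclideanSpace ℝ (Fin d))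
    (A : ℝ → EuclideanSpace ℝ (Fin d)) : Prop :=
  ∀ i < n, ∀ x ∈ Set.Icc (cum p i) (cum p (i + 1)),
    A x = pext p i +
      ((x - cum p i) / dist (pext p i) (pext p (i + 1))) • (pext p (i + 1) - pext p i)

/-- `z` is the portal of the vertical grid edge `{cum p i} × [cum q j, cum q (j+1)]` of the
free space diagram: the unique point minimizing the elevation `(x,y) ↦ dist (A x) (B y)` on
that edge, except that the portals of the grid edges incident to the corners `(0,0)` and
`(cum p n, cum q m)` are placed at those corners. -/
def IsVPortal {d n m : ℕ} (p : Fin (n + 1) → EuclideanSpace ℝ (Fin d))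
    (q : Fin (m + 1) → EuclideanSpace ℝ (Fin d))
    (A B : ℝ → EuclideanSpace ℝ (Fin d)) (i j : ℕ) (z : ℝ × ℝ) : Prop :=
  (i = 0 ∧ j = 0 ∧ z = ((0 : ℝ), (0 : ℝ))) ∨
  (i = n ∧ j = m - 1 ∧ z = (cum p n, cum q m)) ∨
  (¬(i = 0 ∧ j = 0) ∧ ¬(i = n ∧ j = m - 1) ∧
    z.1 = cum p i ∧ z.2 ∈ Set.Icc (cum q j) (cum q (j + 1)) ∧
    ∀ y ∈ Set.Icc (cum q j) (cum q (j + 1)),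
      dist (A z.1) (B z.2) ≤ dist (A (cum p i)) (B y))

/-- `z` is the portal of the horizontal grid edge `[cum p i, cum p (i+1)] × {cum q j}`. -/
def IsHPortal {d n m : ℕ} (p : Fin (n + 1) → EuclideanSpace ℝ (Fin d))
    (q : Fin (m + 1) → EuclideanSpace ℝ (Fin d))
    (A B : ℝ → EuclideanSpace ℝ (Fin d)) (i j : ℕ) (z : ℝ × ℝ) : Prop :=
  (i = 0 ∧ j = 0 ∧ z = ((0 : ℝ), (0 : ℝ))) ∨
  (i = n - 1 ∧ j = m ∧ z = (cum p n, cum q m)) ∨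
  (¬(i = 0 ∧ j = 0) ∧ ¬(i = n - 1 ∧ j = m) ∧
    z.2 = cum q j ∧ z.1 ∈ Set.Icc (cum p i) (cum p (i + 1)) ∧
    ∀ x ∈ Set.Icc (cum p i) (cum p (i + 1)),
      dist (A z.1) (B z.2) ≤ dist (A x) (B (cum q j)))

/-- The directed edges of the VE graph: inside each grid cell `(i,j)`, from the portals of
its left and bottom edges to the portals of its right and top edges. -/
def VEEdge {d n m : ℕ} (p : Fin (n + 1) → EuclideanSpace ℝ (Fin d))
    (q : Fin (m + 1) → EuclideanSpace ℝ (Fin d))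
    (A B : ℝ → EuclideanSpace ℝ (Fin d)) (u v : ℝ × ℝ) : Prop :=
  ∃ i < n, ∃ j < m,
    (IsVPortal p q A B i j u ∨ IsHPortal p q A B i j u) ∧
    (IsVPortal p q A B (i + 1) j v ∨ IsHPortal p q A B i (j + 1) v)

/-- A directed path in the VE graph from `s = (0,0)` to `t = (cum p n, cum q m)`. -/
def IsVEPath {d n m : ℕ} (p : Fin (n + 1) → EuclideanSpace ℝ (Fin d))
    (q : Fin (m + 1) → EuclideanSpace ℝ (Fin d))
    (A B : ℝ → EuclideanSpace ℝ (Fin d)) (l : List (ℝ × ℝ)) : Prop :=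
  l.head? = some ((0 : ℝ), (0 : ℝ)) ∧ l.getLast? = some (cum p n, cum q m) ∧
    l.Chain' (VEEdge p q A B)

/-- The width (maximum height/elevation of a vertex) of a path in the free-space diagram. -/
noncomputable def pathWidth {d : ℕ} (A B : ℝ → EuclideanSpace ℝ (Fin d))
    (l : List (ℝ × ℝ)) : ℝ :=
  sSup ((fun z : ℝ × ℝ => dist (A z.1) (B z.2)) '' { z | z ∈ l })

/-- The VE Fréchet distance: the minimum width of a directed path in the VE graph from
`s` to `t`. -/
noncomputable def dVE {d n m : ℕ} (p : Fin (n + 1) → EuclideanSpace ℝ (Fin d))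
    (q : Fin (m + 1) → EuclideanSpace ℝ (Fin d))
    (A B : ℝ → EuclideanSpace ℝ (Fin d)) : ℝ :=
  sInf { r | ∃ l, IsVEPath p q A B l ∧ r = pathWidth A B l }

/-- A weakly monotone continuous reparameterization of `[0,1]` onto `[0,L]`. -/
def IsReparamTo (L : ℝ) (φ : ℝ → ℝ) : Prop :=
  ContinuousOn φ (Set.Icc 0 1) ∧ MonotoneOn φ (Set.Icc 0 1) ∧
    φ '' Set.Icc 0 1 = Set.Icc 0 L

/-- The (monotone, continuous) Fréchet distance between curves `A : [0,LP] → ℝ^d` and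
`B : [0,LQ] → ℝ^d`. -/
noncomputable def frechetDistL {d : ℕ} (LP LQ : ℝ)
    (A B : ℝ → EuclideanSpace ℝ (Fin d)) : ℝ :=
  sInf { r | ∃ φ ψ, IsReparamTo LP φ ∧ IsReparamTo LQ ψ ∧
    r = sSup ((fun t => dist (A (φ t)) (B (ψ t))) '' Set.Icc (0 : ℝ) 1) }

lemma cum_zero {d n : ℕ} (p : Fin (n + 1) → EuclideanSpace ℝ (Fin d)) : cum p 0 = 0 := by
  simp [cum]

lemma cum_monotone {d n : ℕ} (p : Fin (n + 1) → EuclideanSpace ℝ (Fin d)) :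
    Monotone (cum p) := by
  intro i j hij
  refine Finset.sum_le_sum_of_subset_of_nonneg ?_ fun _ _ _ => dist_nonneg
  exact Finset.range_subset_range.2 (min_le_min_right _ hij)

lemma cum_nonneg {d n : ℕ} (p : Fin (n + 1) → EuclideanSpace ℝ (Fin d)) (i : ℕ) :
    0 ≤ cum p i :=
  Finset.sum_nonneg fun _ _ => dist_nonneg

namespace IsArcParam

variable {d n : ℕ} {p : Fin (n + 1) → EuclideanSpace ℝ (Fin d)}
  {A : ℝ → EuclideanSpace ℝ (Fin d)}

lemma continuousOn_piece (hA : IsArcParam p A) {i : ℕ} (hi : i < n) :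
    ContinuousOn A (Icc (cum p i) (cum p (i + 1))) := by
  refine ContinuousOn.congr (Continuous.continuousOn ?_) (hA i hi)
  fun_prop

lemma isBounded_image (hA : IsArcParam p A) :
    Bornology.IsBounded (A '' Icc 0 (cum p n)) := by
  have key : ∀ k ≤ n, Bornology.IsBounded (A '' Icc 0 (cum p k)) := by
    intro k
    induction k with
    | zero => intro _; simp [cum_zero]
    | succ k ih =>
      intro hk
      rw [← Icc_union_Icc_eq_Icc (cum_nonneg p k) (cum_monotone p k.le_succ), image_union]
      exact (ih (by omega)).union
        (isCompact_Icc.image_of_continuousOn (hA.continuousOn_piece (by omega))).isBounded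
  exact key n le_rfl

/-- On each edge of the curve, the arc-length parameterization is affine. -/
lemma apply_segment (hA : IsArcParam p A) {i : ℕ} (hi : i < n) {x y s : ℝ}
    (hx : x ∈ Icc (cum p i) (cum p (i + 1))) (hy : y ∈ Icc (cum p i) (cum p (i + 1)))
    (hs : s ∈ Icc (0 : ℝ) 1) :
    A (x + (y - x) * s) = (1 - s) • A x + s • A y := by
  have hz : x + (y - x) * s ∈ Icc (cum p i) (cum p (i + 1)) := by
    have := (convex_Icc (cum p i) (cum p (i + 1))) hx hy (sub_nonneg.2 hs.2) hs.1 (by ring)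
    convert this using 1
    simp only [smul_eq_mul]; ring
  rw [hA i hi _ hx, hA i hi _ hy, hA i hi _ hz]
  simp only [div_eq_mul_inv]
  module

end IsArcParam

section Portals

variable {d n m : ℕ} {p : Fin (n + 1) → EuclideanSpace ℝ (Fin d)}
  {q : Fin (m + 1) → EuclideanSpace ℝ (Fin d)} {A B : ℝ → EuclideanSpace ℝ (Fin d)}

lemma IsVPortal.mem_edge {i j : ℕ} {z : ℝ × ℝ} (hj : j < m) (h : IsVPortal p q A B i j z) :
    z.1 = cum p i ∧ z.2 ∈ Icc (cum q j) (cum q (j + 1)) := by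
  have hc := cum_monotone q j.le_succ
  rcases h with ⟨rfl, rfl, rfl⟩ | ⟨rfl, rfl, rfl⟩ | ⟨-, -, h1, h2, -⟩
  · exact ⟨(cum_zero p).symm, by simpa [cum_zero] using hc⟩
  · rw [Nat.succ_eq_add_one, Nat.sub_add_cancel (by omega)] at hc
    exact ⟨rfl, by rw [Nat.sub_add_cancel (by omega)]; exact ⟨hc, le_rfl⟩⟩
  · exact ⟨h1, h2⟩

lemma IsHPortal.mem_edge {i j : ℕ} {z : ℝ × ℝ} (hi : i < n) (h : IsHPortal p q A B i j z) :
    z.2 = cum q j ∧ z.1 ∈ Icc (cum p i) (cum p (i + 1)) := by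
  have hc := cum_monotone p i.le_succ
  rcases h with ⟨rfl, rfl, rfl⟩ | ⟨rfl, rfl, rfl⟩ | ⟨-, -, h1, h2, -⟩
  · exact ⟨(cum_zero q).symm, by simpa [cum_zero] using hc⟩
  · rw [Nat.succ_eq_add_one, Nat.sub_add_cancel (by omega)] at hc
    exact ⟨rfl, by rw [Nat.sub_add_cancel (by omega)]; exact ⟨hc, le_rfl⟩⟩
  · exact ⟨h1, h2⟩

/-- Both endpoints of an edge of the VE graph lie in a common grid cell. -/
lemma VEEdge.exists_cell {u v : ℝ × ℝ} (h : VEEdge p q A B u v) :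
    ∃ i < n, ∃ j < m,
      u.1 ∈ Icc (cum p i) (cum p (i + 1)) ∧ u.2 ∈ Icc (cum q j) (cum q (j + 1)) ∧
      v.1 ∈ Icc (cum p i) (cum p (i + 1)) ∧ v.2 ∈ Icc (cum q j) (cum q (j + 1)) := by
  obtain ⟨i, hi, j, hj, hu, hv⟩ := h
  have hp := cum_monotone p i.le_succ
  have hq := cum_monotone q j.le_succ
  have hu' : u.1 ∈ Icc (cum p i) (cum p (i + 1)) ∧ u.2 ∈ Icc (cum q j) (cum q (j + 1)) := by
    rcases hu with hu | hu
    · have h := hu.mem_edge hj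
      exact ⟨⟨h.1.ge, h.1.le.trans hp⟩, h.2⟩
    · have h := hu.mem_edge hi
      exact ⟨h.2, h.1.ge, h.1.le.trans hq⟩
  have hv' : v.1 ∈ Icc (cum p i) (cum p (i + 1)) ∧ v.2 ∈ Icc (cum q j) (cum q (j + 1)) := by
    rcases hv with hv | hv
    · have h := hv.mem_edge hj
      exact ⟨⟨hp.trans h.1.ge, h.1.le⟩, h.2⟩
    · have h := hv.mem_edge hi
      exact ⟨h.2, hq.trans h.1.ge, h.1.le⟩
  exact ⟨i, hi, j, hj, hu'.1, hu'.2, hv'.1, hv'.2⟩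

/-- The elevation is convex on grid cells. -/
lemma VEEdge.dist_segment_le (hA : IsArcParam p A) (hB : IsArcParam q B) {u v : ℝ × ℝ}
    (h : VEEdge p q A B u v) {r s : ℝ} (hs : s ∈ Icc (0 : ℝ) 1)
    (hu : dist (A u.1) (B u.2) ≤ r) (hv : dist (A v.1) (B v.2) ≤ r) :
    dist (A (u.1 + (v.1 - u.1) * s)) (B (u.2 + (v.2 - u.2) * s)) ≤ r := by
  obtain ⟨i, hi, j, hj, h1, h2, h3, h4⟩ := h.exists_cell
  rw [hA.apply_segment hi h1 h3 hs, hB.apply_segment hj h2 h4 hs]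
  refine (dist_add_add_le _ _ _ _).trans ?_
  rw [dist_smul₀, dist_smul₀, Real.norm_of_nonneg hs.1, Real.norm_of_nonneg (sub_nonneg.2 hs.2)]
  nlinarith [mul_le_mul_of_nonneg_left hu (sub_nonneg.2 hs.2), mul_le_mul_of_nonneg_left hv hs.1]

lemma exists_isVPortal (hB : IsArcParam q B) {i j : ℕ} (hi0 : i ≠ 0) (hin : i ≠ n) (hj : j < m) :
    ∃ z, IsVPortal p q A B i j z ∧
      ∀ y ∈ Icc (cum q j) (cum q (j + 1)),
        dist (A z.1) (B z.2) ≤ dist (A (cum p i)) (B y) := by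
  obtain ⟨y, hy, hmin⟩ := isCompact_Icc.exists_isMinOn
    (nonempty_Icc.2 (cum_monotone q j.le_succ))
    (continuous_dist.comp_continuousOn
      ((continuousOn_const (c := A (cum p i))).prodMk (hB.continuousOn_piece hj)))
  exact ⟨(cum p i, y), Or.inr (Or.inr ⟨fun h => hi0 h.1, fun h => hin h.1, rfl, hy, hmin⟩), hmin⟩

lemma exists_isHPortal (hA : IsArcParam p A) {i j : ℕ} (hj0 : j ≠ 0) (hjm : j ≠ m) (hi : i < n) :
    ∃ z, IsHPortal p q A B i j z ∧
      ∀ x ∈ Icc (cum p i) (cum p (i + 1)),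
        dist (A z.1) (B z.2) ≤ dist (A x) (B (cum q j)) := by
  obtain ⟨x, hx, hmin⟩ := isCompact_Icc.exists_isMinOn
    (nonempty_Icc.2 (cum_monotone p i.le_succ))
    (continuous_dist.comp_continuousOn
      ((hA.continuousOn_piece hi).prodMk (continuousOn_const (c := B (cum q j)))))
  exact ⟨(x, cum q j), Or.inr (Or.inr ⟨fun h => hj0 h.2, fun h => hjm h.2, rfl, hx, hmin⟩), hmin⟩

end Portals

namespace IsReparamTo

variable {L : ℝ} {φ : ℝ → ℝ}

lemma of_continuous_monotone (hc : Continuous φ) (hm : Monotone φ) (h0 : φ 0 = 0)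
    (h1 : φ 1 = L) : IsReparamTo L φ := by
  refine ⟨hc.continuousOn, hm.monotoneOn _, Subset.antisymm ?_ ?_⟩
  · rintro _ ⟨t, ht, rfl⟩
    exact ⟨h0 ▸ hm ht.1, h1 ▸ hm ht.2⟩
  · have := intermediate_value_Icc zero_le_one hc.continuousOn
    rwa [h0, h1] at this

lemma mem_Icc (h : IsReparamTo L φ) {t : ℝ} (ht : t ∈ Icc (0 : ℝ) 1) : φ t ∈ Icc 0 L :=
  h.2.2 ▸ mem_image_of_mem φ ht

/-- A value not yet exceeded at time `t` is attained at some time `t' ≥ t`. -/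
lemma exists_ge_eq (h : IsReparamTo L φ) {t x : ℝ} (ht : t ∈ Icc (0 : ℝ) 1)
    (hx : φ t ≤ x) (hxL : x ≤ L) : ∃ t' ∈ Icc (0 : ℝ) 1, t ≤ t' ∧ φ t' = x := by
  obtain ⟨t', ht', rfl⟩ : x ∈ φ '' Icc 0 1 := h.2.2 ▸ ⟨(h.mem_Icc ht).1.trans hx, hxL⟩
  rcases le_total t t' with htt | htt
  · exact ⟨t', ht', htt, rfl⟩
  · exact ⟨t, ht, le_rfl, hx.antisymm (h.2.1 ht' ht htt)⟩

lemma apply_zero (h : IsReparamTo L φ) : φ 0 = 0 := by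
  have h0 := h.mem_Icc (left_mem_Icc.2 zero_le_one)
  obtain ⟨t, ht, hφ⟩ : (0 : ℝ) ∈ φ '' Icc 0 1 := h.2.2 ▸ ⟨le_rfl, h0.1.trans h0.2⟩
  exact (hφ ▸ h.2.1 (left_mem_Icc.2 zero_le_one) ht ht.1).antisymm h0.1

lemma apply_one (h : IsReparamTo L φ) : φ 1 = L := by
  have h1 := right_mem_Icc.2 (zero_le_one (α := ℝ))
  obtain ⟨t, ht, htt, hφ⟩ := h.exists_ge_eq h1 (h.mem_Icc h1).2 le_rfl
  rwa [htt.antisymm ht.2]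

end IsReparamTo

section Comparison

variable {d n m : ℕ} {p : Fin (n + 1) → EuclideanSpace ℝ (Fin d)}
  {q : Fin (m + 1) → EuclideanSpace ℝ (Fin d)} {A B : ℝ → EuclideanSpace ℝ (Fin d)}

/-- A monotone chain of VE edges is traced by a morphing that is no higher than its vertices. -/
lemma exists_morphing_of_isChain (hA : IsArcParam p A) (hB : IsArcParam q B) {r : ℝ}
    {w : ℝ × ℝ} (l : List (ℝ × ℝ)) (u : ℝ × ℝ)
    (hw : (u :: l).getLast? = some w) (hl : (u :: l).IsChain (VEEdge p q A B))
    (hm : (u :: l).IsChain (fun u v : ℝ × ℝ => u.1 ≤ v.1 ∧ u.2 ≤ v.2))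
    (hr : ∀ z ∈ u :: l, dist (A z.1) (B z.2) ≤ r) :
    ∃ φ ψ : ℝ → ℝ, Continuous φ ∧ Monotone φ ∧ φ 0 = u.1 ∧ φ 1 = w.1 ∧
      Continuous ψ ∧ Monotone ψ ∧ ψ 0 = u.2 ∧ ψ 1 = w.2 ∧
      ∀ t ∈ Icc (0 : ℝ) 1, dist (A (φ t)) (B (ψ t)) ≤ r := by
  induction l generalizing u with
  | nil =>
    obtain rfl : u = w := by simpa using hw
    exact ⟨fun _ => u.1, fun _ => u.2, continuous_const, monotone_const, rfl, rfl,
      continuous_const, monotone_const, rfl, rfl, fun _ _ => hr u (by simp)⟩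
  | cons v l ih =>
    rw [List.isChain_cons_cons] at hl hm
    obtain ⟨φ, ψ, hφc, hφm, hφ0, hφ1, hψc, hψm, hψ0, hψ1, h⟩ :=
      ih v (by simpa using hw) hl.2 hm.2 fun z hz => hr z (List.mem_cons_of_mem _ hz)
    have mono : ∀ {a b : ℝ} {f : ℝ → ℝ}, a ≤ b → Monotone f → Monotone
        fun t : ℝ => a + (b - a) * min 1 (2 * t) + (f (max (2 * t - 1) 0) - b) := by
      intro a b f hab hf s t hst
      have h1 : min 1 (2 * s) ≤ min 1 (2 * t) := by gcongr
      have h2 : f (max (2 * s - 1) 0) ≤ f (max (2 * t - 1) 0) := hf (by gcongr)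
      have h3 := mul_le_mul_of_nonneg_left h1 (sub_nonneg.2 hab)
      dsimp only
      linarith
    refine ⟨fun t => u.1 + (v.1 - u.1) * min 1 (2 * t) + (φ (max (2 * t - 1) 0) - v.1),
      fun t => u.2 + (v.2 - u.2) * min 1 (2 * t) + (ψ (max (2 * t - 1) 0) - v.2),
      by fun_prop, mono hm.1.1 hφm, by simp [hφ0], by norm_num [hφ1],
      by fun_prop, mono hm.1.2 hψm, by simp [hψ0], by norm_num [hψ1], ?_⟩
    intro t ht
    dsimp only
    rcases le_total (2 * t) 1 with h2 | h2
    · rw [min_eq_right h2, max_eq_right (by linarith), hφ0, hψ0, sub_self, sub_self,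
        add_zero, add_zero]
      exact hl.1.dist_segment_le hA hB ⟨by linarith [ht.1], h2⟩ (hr u (by simp)) (hr v (by simp))
    · rw [min_eq_left h2, max_eq_left (by linarith)]
      convert h (2 * t - 1) ⟨by linarith, by linarith [ht.2]⟩ using 3 <;> ring

/-- From any cell met by a morphing of height at most `r`, the VE graph can be followed to the
final corner through vertices of height at most `r`. -/
lemma exists_chain_of_morphing (hA : IsArcParam p A) (hB : IsArcParam q B) {r : ℝ} {φ ψ : ℝ → ℝ}
    (hφ : IsReparamTo (cum p n) φ) (hψ : IsReparamTo (cum q m) ψ)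
    (hr : ∀ t ∈ Icc (0 : ℝ) 1, dist (A (φ t)) (B (ψ t)) ≤ r) (k i j : ℕ)
    (hk : n - i + (m - j) ≤ k) (hi : i < n) (hj : j < m) {t : ℝ} (ht : t ∈ Icc (0 : ℝ) 1)
    (htφ : φ t ∈ Icc (cum p i) (cum p (i + 1))) (htψ : ψ t ∈ Icc (cum q j) (cum q (j + 1)))
    (u : ℝ × ℝ) (hu : IsVPortal p q A B i j u ∨ IsHPortal p q A B i j u)
    (hur : dist (A u.1) (B u.2) ≤ r) :
    ∃ l : List (ℝ × ℝ), (u :: l).getLast? = some (cum p n, cum q m) ∧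
      (u :: l).IsChain (VEEdge p q A B) ∧ ∀ z ∈ u :: l, dist (A z.1) (B z.2) ≤ r := by
  induction k generalizing i j t u with
  | zero => omega
  | succ k ih =>
    have extend : ∀ v : ℝ × ℝ, VEEdge p q A B u v →
        (∃ l : List (ℝ × ℝ), (v :: l).getLast? = some (cum p n, cum q m) ∧
          (v :: l).IsChain (VEEdge p q A B) ∧ ∀ z ∈ v :: l, dist (A z.1) (B z.2) ≤ r) →
        ∃ l : List (ℝ × ℝ), (u :: l).getLast? = some (cum p n, cum q m) ∧
          (u :: l).IsChain (VEEdge p q A B) ∧ ∀ z ∈ u :: l, dist (A z.1) (B z.2) ≤ r := by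
      rintro v huv ⟨l, h1, h2, h3⟩
      exact ⟨v :: l, by simpa using h1, List.isChain_cons_cons.2 ⟨huv, h2⟩,
        List.forall_mem_cons.2 ⟨hur, h3⟩⟩
    obtain ⟨t₁, ht₁, htt₁, hφt₁⟩ := hφ.exists_ge_eq ht htφ.2 (cum_monotone p hi)
    obtain ⟨t₂, ht₂, htt₂, hψt₂⟩ := hψ.exists_ge_eq ht htψ.2 (cum_monotone q hj)
    have right : i + 1 < n → ψ t₁ ≤ cum q (j + 1) →
        ∃ l : List (ℝ × ℝ), (u :: l).getLast? = some (cum p n, cum q m) ∧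
          (u :: l).IsChain (VEEdge p q A B) ∧ ∀ z ∈ u :: l, dist (A z.1) (B z.2) ≤ r := by
      intro hi' hle
      have hmem : ψ t₁ ∈ Icc (cum q j) (cum q (j + 1)) :=
        ⟨htψ.1.trans (hψ.2.1 ht ht₁ htt₁), hle⟩
      obtain ⟨v, hv, hmin⟩ := exists_isVPortal (p := p) (A := A) hB i.succ_ne_zero hi'.ne hj
      refine extend v ⟨i, hi, j, hj, hu, Or.inl hv⟩ (ih (i + 1) j (by omega) hi' hj ht₁
        ⟨hφt₁.ge, hφt₁.le.trans (cum_monotone p (Nat.le_succ _))⟩ hmem v (Or.inl hv) ?_)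
      exact (hmin _ hmem).trans (hφt₁ ▸ hr t₁ ht₁)
    have up : j + 1 < m → φ t₂ ≤ cum p (i + 1) →
        ∃ l : List (ℝ × ℝ), (u :: l).getLast? = some (cum p n, cum q m) ∧
          (u :: l).IsChain (VEEdge p q A B) ∧ ∀ z ∈ u :: l, dist (A z.1) (B z.2) ≤ r := by
      intro hj' hle
      have hmem : φ t₂ ∈ Icc (cum p i) (cum p (i + 1)) :=
        ⟨htφ.1.trans (hφ.2.1 ht ht₂ htt₂), hle⟩
      obtain ⟨v, hv, hmin⟩ := exists_isHPortal (q := q) (B := B) hA j.succ_ne_zero hj'.ne hi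
      refine extend v ⟨i, hi, j, hj, hu, Or.inr hv⟩ (ih i (j + 1) (by omega) hi hj' ht₂
        hmem ⟨hψt₂.ge, hψt₂.le.trans (cum_monotone q (Nat.le_succ _))⟩ v (Or.inr hv) ?_)
      exact (hmin _ hmem).trans (hψt₂ ▸ hr t₂ ht₂)
    rcases Nat.lt_or_ge (i + 1) n with hi' | hi'
    · rcases Nat.lt_or_ge (j + 1) m with hj' | hj'
      · rcases le_total t₁ t₂ with h | h
        · exact right hi' (hψt₂ ▸ hψ.2.1 ht₁ ht₂ h)
        · exact up hj' (hφt₁ ▸ hφ.2.1 ht₂ ht₁ h)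
      · exact right hi' (((hψ.mem_Icc ht₁).2).trans (cum_monotone q hj'))
    · rcases Nat.lt_or_ge (j + 1) m with hj' | hj'
      · exact up hj' (((hφ.mem_Icc ht₂).2).trans (cum_monotone p hi'))
      · have hlast : dist (A (cum p n)) (B (cum q m)) ≤ r := by
          have := hr 1 (right_mem_Icc.2 zero_le_one)
          rwa [hφ.apply_one, hψ.apply_one] at this
        exact extend (cum p n, cum q m)
          ⟨i, hi, j, hj, hu, Or.inl (Or.inr (Or.inl ⟨by omega, by omega, rfl⟩))⟩
          ⟨[], by simp, by simp, by simpa using hlast⟩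

lemma pathWidth_nonneg (l : List (ℝ × ℝ)) : 0 ≤ pathWidth A B l :=
  Real.sSup_nonneg (by rintro _ ⟨z, -, rfl⟩; exact dist_nonneg)

lemma dist_le_pathWidth {l : List (ℝ × ℝ)} {z : ℝ × ℝ} (hz : z ∈ l) :
    dist (A z.1) (B z.2) ≤ pathWidth A B l :=
  le_csSup ((List.finite_toSet l).image _).bddAbove ⟨z, hz, rfl⟩

/-- A morphing of height at most `r` bounds the VE Fréchet distance by `r`. -/
lemma dVE_le_of_morphing (hn : 1 ≤ n) (hm : 1 ≤ m) (hA : IsArcParam p A) (hB : IsArcParam q B)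
    {r : ℝ} {φ ψ : ℝ → ℝ} (hφ : IsReparamTo (cum p n) φ) (hψ : IsReparamTo (cum q m) ψ)
    (hr : ∀ t ∈ Icc (0 : ℝ) 1, dist (A (φ t)) (B (ψ t)) ≤ r) : dVE p q A B ≤ r := by
  have h0 : (0 : ℝ) ∈ Icc (0 : ℝ) 1 := left_mem_Icc.2 zero_le_one
  have hs : dist (A 0) (B 0) ≤ r := by
    have := hr 0 h0
    rwa [hφ.apply_zero, hψ.apply_zero] at this
  obtain ⟨l, hlast, hchain, hl⟩ := exists_chain_of_morphing hA hB hφ hψ hr _ 0 0 le_rfl hn hm h0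
    (by simpa [cum_zero, hφ.apply_zero] using cum_nonneg p 1)
    (by simpa [cum_zero, hψ.apply_zero] using cum_nonneg q 1)
    (0, 0) (Or.inl (Or.inl ⟨rfl, rfl, rfl⟩)) hs
  refine csInf_le_of_le ⟨0, ?_⟩ ⟨(0, 0) :: l, ⟨rfl, hlast, hchain⟩, rfl⟩
    (Real.sSup_le ?_ (dist_nonneg.trans hs))
  · rintro _ ⟨l, -, rfl⟩
    exact pathWidth_nonneg l
  · rintro _ ⟨z, hz, rfl⟩
    exact hl z hz

/-- The elevation along a morphing is bounded above. -/
lemma bddAbove_elevation (hA : IsArcParam p A) (hB : IsArcParam q B) {φ ψ : ℝ → ℝ}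
    (hφ : IsReparamTo (cum p n) φ) (hψ : IsReparamTo (cum q m) ψ) :
    BddAbove ((fun t => dist (A (φ t)) (B (ψ t))) '' Icc (0 : ℝ) 1) := by
  obtain ⟨C, hC⟩ := Metric.isBounded_iff.1 (hA.isBounded_image.union hB.isBounded_image)
  refine ⟨C, ?_⟩
  rintro _ ⟨t, ht, rfl⟩
  exact hC (Or.inl (mem_image_of_mem _ (hφ.mem_Icc ht)))
    (Or.inr (mem_image_of_mem _ (hψ.mem_Icc ht)))

end Comparison

/-- If some optimal path in the VE graph (one whose width equals the
VE Fréchet distance) is monotone in both coordinates, then the Fréchet distance equals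
the VE Fréchet distance. -/
theorem monotone_optimal_ve_path_realizes_frechet (d n m : ℕ) (hn : 1 ≤ n) (hm : 1 ≤ m)
    (p : Fin (n + 1) → EuclideanSpace ℝ (Fin d))
    (q : Fin (m + 1) → EuclideanSpace ℝ (Fin d))
    (hp : ∀ i < n, pext p i ≠ pext p (i + 1))
    (hq : ∀ j < m, pext q j ≠ pext q (j + 1))
    (A B : ℝ → EuclideanSpace ℝ (Fin d))
    (hA : IsArcParam p A) (hB : IsArcParam q B)
    (hmono : ∃ l : List (ℝ × ℝ), IsVEPath p q A B l ∧
      pathWidth A B l = dVE p q A B ∧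
      l.Chain' (fun u v : ℝ × ℝ => u.1 ≤ v.1 ∧ u.2 ≤ v.2)) :
    frechetDistL (cum p n) (cum q m) A B = dVE p q A B := by
  obtain ⟨l, ⟨hhead, hlast, hchain⟩, hwidth, hmono⟩ := hmono
  obtain ⟨l, rfl⟩ : ∃ l', l = (0, 0) :: l' := by
    cases l with
    | nil => simp at hhead
    | cons a l => exact ⟨l, by simpa using hhead⟩
  obtain ⟨φ, ψ, hφc, hφm, hφ0, hφ1, hψc, hψm, hψ0, hψ1, h⟩ :=
    exists_morphing_of_isChain hA hB l (0, 0) hlast hchain hmono fun _ => dist_le_pathWidth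
  have hφ := IsReparamTo.of_continuous_monotone hφc hφm hφ0 hφ1
  have hψ := IsReparamTo.of_continuous_monotone hψc hψm hψ0 hψ1
  apply le_antisymm
  · rw [← hwidth]
    refine csInf_le_of_le ⟨0, ?_⟩ ⟨φ, ψ, hφ, hψ, rfl⟩ (Real.sSup_le ?_ (pathWidth_nonneg _))
    · rintro _ ⟨φ, ψ, -, -, rfl⟩
      exact Real.sSup_nonneg (by rintro _ ⟨t, -, rfl⟩; exact dist_nonneg)
    · rintro _ ⟨t, ht, rfl⟩
      exact h t ht
  · refine le_csInf ⟨_, φ, ψ, hφ, hψ, rfl⟩ ?_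
    rintro _ ⟨φ, ψ, hφ, hψ, rfl⟩
    exact dVE_le_of_morphing hn hm hA hB hφ hψ fun t ht =>
      le_csSup (bddAbove_elevation hA hB hφ hψ) (mem_image_of_mem _ ht)
end

section
/- For every integer m ≥ 2, set δ = 1/(2m), and consider the one-dimensional polygonal curves A with vertex sequence 0, 1, δ, 1−δ, 2δ, 1−2δ, …, 1/2−δ, 1/2+δ, 1/2 and Ā with vertex sequence 0, 1−δ, 2δ, 1−2δ, …, 1/2−δ, 1/2+δ, 1/2 (Ā is A with the vertices 1 and δ removed, so Ā is a vertex-subcurve of A with the same endpoints). Then d_F(A, Ā) ≤ 2δ, while d_F(B, e) ≥ (1−δ)/2, where B is the polygonal curve with vertex sequence 0, 1, δ, 1−δ and e is the segment from 0 to 1−δ. In particular, the edgewise Fréchet error of matching each edge of Ā to its corresponding subcurve of A can exceed any constant multiple of d_F(A, Ā). -/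
open Set

/-- A weakly monotone continuous surjective reparameterization of `[0,1]`. -/
def Reparam (φ : ℝ → ℝ) : Prop :=
  ContinuousOn φ (Set.Icc 0 1) ∧ MonotoneOn φ (Set.Icc 0 1) ∧
    φ '' Set.Icc 0 1 = Set.Icc 0 1

/-- The (continuous, monotone) Fréchet distance between two curves parameterized
over `[0,1]`. -/
noncomputable def frechetDist {V : Type*} [NormedAddCommGroup V] [NormedSpace ℝ V]
    (f g : ℝ → V) : ℝ :=
  sInf { r | ∃ φ ψ, Reparam φ ∧ Reparam ψ ∧
    r = sSup ((fun t => ‖f (φ t) - g (ψ t)‖) '' Set.Icc (0 : ℝ) 1) }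

/-- The polygonal curve through the vertices `p 0, …, p n`, parameterized over `[0,1]`. -/
noncomputable def polyCurve {V : Type*} [NormedAddCommGroup V] [NormedSpace ℝ V]
    {n : ℕ} (p : Fin (n + 1) → V) : ℝ → V := fun t =>
  let s := t * n
  let i := min ⌊s⌋₊ (n - 1)
  (1 - (s - (i : ℝ))) • p ⟨i, Nat.lt_succ_of_le ((min_le_right _ _).trans (Nat.sub_le _ _))⟩ +
    (s - (i : ℝ)) • p ⟨min (i + 1) n, Nat.lt_succ_of_le (min_le_right _ _)⟩

/-- The vertex sequence `0, 1, δ, 1−δ, 2δ, 1−2δ, …, 1/2−δ, 1/2+δ, 1/2` (with `δ = 1/(2m)`),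
a one-dimensional zig-zag curve with `2m+1` vertices. -/
noncomputable def zigzagA (m : ℕ) : Fin (2 * m + 1) → ℝ := fun j =>
  if j.val = 0 then 0
  else if j.val = 1 then 1
  else if j.val % 2 = 0 then ((j.val / 2 : ℕ) : ℝ) * (1 / (2 * m) : ℝ)
  else 1 - ((j.val / 2 : ℕ) : ℝ) * (1 / (2 * m) : ℝ)

/-- The curve `zigzagA` with its vertices `1` and `δ` (indices `1` and `2`) removed:
`0, 1−δ, 2δ, 1−2δ, …, 1/2−δ, 1/2+δ, 1/2`, a subcurve with `2m−1` vertices. -/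
noncomputable def zigzagAbar (m : ℕ) : Fin (2 * (m - 1) + 1) → ℝ := fun j =>
  if j.val = 0 then 0
  else zigzagA m ⟨min (j.val + 2) (2 * m), Nat.lt_succ_of_le (min_le_right _ _)⟩

theorem Reparam.of_endpoints {φ : ℝ → ℝ} (hc : ContinuousOn φ (Icc 0 1))
    (hmono : MonotoneOn φ (Icc 0 1)) (h0 : φ 0 = 0) (h1 : φ 1 = 1) : Reparam φ := by
  refine ⟨hc, hmono, Subset.antisymm ?_ ?_⟩
  · rintro _ ⟨t, ht, rfl⟩
    exact ⟨h0 ▸ hmono (left_mem_Icc.2 zero_le_one) ht ht.1,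
      h1 ▸ hmono ht (right_mem_Icc.2 zero_le_one) ht.2⟩
  · simpa only [h0, h1] using intermediate_value_Icc zero_le_one hc

theorem Reparam.id : Reparam fun t => t :=
  .of_endpoints continuousOn_id monotoneOn_id rfl rfl

theorem Reparam.mem_Icc {φ : ℝ → ℝ} (h : Reparam φ) {t : ℝ} (ht : t ∈ Icc (0 : ℝ) 1) :
    φ t ∈ Icc (0 : ℝ) 1 :=
  h.2.2 ▸ mem_image_of_mem φ ht

section

variable {V : Type*} [NormedAddCommGroup V] [NormedSpace ℝ V]

theorem frechetDist_le {f g : ℝ → V} {φ ψ : ℝ → ℝ} {r : ℝ} (hφ : Reparam φ) (hψ : Reparam ψ)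
    (h : ∀ t ∈ Icc (0 : ℝ) 1, ‖f (φ t) - g (ψ t)‖ ≤ r) : frechetDist f g ≤ r := by
  refine csInf_le_of_le ⟨0, ?_⟩ ⟨φ, ψ, hφ, hψ, rfl⟩
    (csSup_le ((nonempty_Icc.2 zero_le_one).image _) ?_)
  · rintro _ ⟨φ, ψ, -, -, rfl⟩
    refine Real.sSup_nonneg ?_
    rintro _ ⟨t, -, rfl⟩
    exact norm_nonneg _
  · rintro _ ⟨t, ht, rfl⟩
    exact h t ht

theorem le_frechetDist {f g : ℝ → V} {r C D : ℝ} (hf : ∀ t ∈ Icc (0 : ℝ) 1, ‖f t‖ ≤ C)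
    (hg : ∀ t ∈ Icc (0 : ℝ) 1, ‖g t‖ ≤ D)
    (h : ∀ φ ψ, Reparam φ → Reparam ψ → ∀ b,
      (∀ t ∈ Icc (0 : ℝ) 1, ‖f (φ t) - g (ψ t)‖ ≤ b) → r ≤ b) :
    r ≤ frechetDist f g := by
  refine le_csInf ⟨_, _, _, Reparam.id, Reparam.id, rfl⟩ ?_
  rintro _ ⟨φ, ψ, hφ, hψ, rfl⟩
  refine h φ ψ hφ hψ _ fun t ht => le_csSup ⟨C + D, ?_⟩ (mem_image_of_mem _ ht)
  rintro _ ⟨t, ht, rfl⟩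
  exact (norm_sub_le _ _).trans (add_le_add (hf _ (hφ.mem_Icc ht)) (hg _ (hψ.mem_Icc ht)))

theorem polyCurve_eq {n : ℕ} (p : Fin (n + 1) → V) {t : ℝ} {k : ℕ} (hk : k < n)
    (h₁ : (k : ℝ) ≤ t * n) (h₂ : t * n ≤ k + 1) :
    polyCurve p t =
      (1 - (t * n - k)) • p ⟨k, by omega⟩ + (t * n - k) • p ⟨k + 1, by omega⟩ := by
  rcases h₂.lt_or_eq with h | h
  · have hi : min ⌊t * n⌋₊ (n - 1) = k := by
      rw [(Nat.floor_eq_iff ((Nat.cast_nonneg k).trans h₁)).2 ⟨h₁, h⟩]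
      omega
    have hk' : min (k + 1) n = k + 1 := by omega
    simp only [polyCurve, hi, hk']
  · have hfl : ⌊t * n⌋₊ = k + 1 := by
      rw [h]
      exact_mod_cast Nat.floor_natCast (k + 1)
    rcases (show k + 1 < n ∨ k + 1 = n by omega) with hn | hn
    · have hi : min ⌊t * n⌋₊ (n - 1) = k + 1 := by omega
      simp only [polyCurve, hi]
      simp [h]
    · have hi : min ⌊t * n⌋₊ (n - 1) = k := by omega
      have hk' : min (k + 1) n = k + 1 := by omega
      simp only [polyCurve, hi, hk']

theorem exists_edge_index {n : ℕ} (hn : 0 < n) {t : ℝ} (ht : t ∈ Icc (0 : ℝ) 1) :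
    ∃ k < n, (k : ℝ) ≤ t * n ∧ t * n ≤ k + 1 := by
  have h0 : 0 ≤ t * n := mul_nonneg ht.1 n.cast_nonneg
  have h1 : t * n ≤ n := mul_le_of_le_one_left n.cast_nonneg ht.2
  by_cases h : ⌊t * n⌋₊ < n
  · exact ⟨_, h, Nat.floor_le h0, (Nat.lt_floor_add_one _).le⟩
  · have hle : (n : ℝ) ≤ t * n := (Nat.le_floor_iff h0).1 (not_lt.1 h)
    have hc : ((n - 1 : ℕ) : ℝ) = n - 1 := by rw [Nat.cast_sub hn, Nat.cast_one]
    exact ⟨n - 1, by omega, by linarith, by linarith⟩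

theorem polyCurve_mem_of_convex {n : ℕ} (hn : 0 < n) {p : Fin (n + 1) → V} {s : Set V}
    (hs : Convex ℝ s) (hp : ∀ i, p i ∈ s) {t : ℝ} (ht : t ∈ Icc (0 : ℝ) 1) :
    polyCurve p t ∈ s := by
  obtain ⟨k, hk, h₁, h₂⟩ := exists_edge_index hn ht
  rw [polyCurve_eq p hk h₁ h₂]
  exact hs (hp _) (hp _) (by linarith) (by linarith) (by ring)

end

theorem abs_convexCombination_sub_le {a b c d u r : ℝ} (h₀ : 0 ≤ u) (h₁ : u ≤ 1)
    (ha : |a - c| ≤ r) (hb : |b - d| ≤ r) :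
    |((1 - u) * a + u * b) - ((1 - u) * c + u * d)| ≤ r := by
  rw [abs_le] at *
  constructor <;> nlinarith

theorem zigzagA_apply (m : ℕ) (j : Fin (2 * m + 1)) :
    zigzagA m j = if j.val % 2 = 0 then ((j.val / 2 : ℕ) : ℝ) * (1 / (2 * m))
      else 1 - ((j.val / 2 : ℕ) : ℝ) * (1 / (2 * m)) := by
  rw [zigzagA]
  split_ifs with h h' h'' <;> simp_all

theorem abs_zigzagA_sub_zigzagAbar_le (m j : ℕ) (hj : j < 2 * (m - 1) + 1) :
    |zigzagA m ⟨j, by omega⟩ - zigzagAbar m ⟨j, hj⟩| ≤ 1 / (2 * m) := by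
  have hδ : (0 : ℝ) ≤ 1 / (2 * m) := by positivity
  rcases Nat.eq_zero_or_pos j with rfl | h
  · simp [zigzagA, zigzagAbar]
  · have hmin : min (j + 2) (2 * m) = j + 2 := by omega
    have hdiv : (j + 2) / 2 = j / 2 + 1 := by omega
    simp only [zigzagAbar, h.ne', if_false, hmin, zigzagA_apply, Nat.add_mod_right, hdiv,
      Nat.cast_add, Nat.cast_one]
    generalize (1 / (2 * m) : ℝ) = δ at *
    split_ifs <;> rw [abs_le] <;> constructor <;> linarith

theorem abs_zigzagA_sub_half_le {m j : ℕ} (hm : 1 ≤ m) (hj : j < 2 * m + 1)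
    (h : 2 * (m - 1) ≤ j) : |zigzagA m ⟨j, hj⟩ - 1 / 2| ≤ 1 / (2 * m) := by
  obtain ⟨k, rfl⟩ : ∃ k, m = k + 1 := ⟨m - 1, by omega⟩
  have hδ : (0 : ℝ) < 1 / (2 * (k + 1 : ℕ)) := by positivity
  have hk : ((k + 1 : ℕ) : ℝ) * (1 / (2 * (k + 1 : ℕ))) = 1 / 2 := by field_simp
  rw [zigzagA_apply]
  generalize (1 / (2 * (k + 1 : ℕ)) : ℝ) = δ at *
  push_cast at hk
  obtain rfl | rfl | rfl : j = 2 * k ∨ j = 2 * k + 1 ∨ j = 2 * (k + 1) := by omega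
  · have h2 : 2 * k / 2 = k := by omega
    simp only [Nat.mul_mod_right, if_true, h2]
    rw [abs_le]; constructor <;> linarith
  · have h2 : (2 * k + 1) / 2 = k := by omega
    have h3 : (2 * k + 1) % 2 = 1 := by omega
    simp only [h3, one_ne_zero, if_false, h2]
    rw [abs_le]; constructor <;> linarith
  · have h2 : 2 * (k + 1) / 2 = k + 1 := by omega
    simp only [Nat.mul_mod_right, if_true, h2]
    push_cast
    rw [abs_le]; constructor <;> linarith

theorem zigzagAbar_last {m : ℕ} (hm : 2 ≤ m) (h : 2 * (m - 1) < 2 * (m - 1) + 1) :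
    zigzagAbar m ⟨2 * (m - 1), h⟩ = 1 / 2 := by
  have hm' : (m : ℝ) ≠ 0 := by positivity
  have h0 : 2 * (m - 1) ≠ 0 := by omega
  have hmin : min (2 * (m - 1) + 2) (2 * m) = 2 * m := by omega
  have h2 : 2 * m / 2 = m := by omega
  simp only [zigzagAbar, h0, if_false, hmin, zigzagA_apply, Nat.mul_mod_right, if_true, h2]
  field_simp

/-- The traversal of `Ā` at the vertex speed of `A`, waiting at the end. -/
theorem reparam_min_mul {c : ℝ} (hc : 1 ≤ c) : Reparam fun t => min (t * c) 1 := by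
  refine .of_endpoints (by fun_prop) ?_ (by simp) (by simpa using hc)
  intro x _ y _ hxy
  exact min_le_min_right _ (mul_le_mul_of_nonneg_right hxy (by linarith))

theorem frechetDist_zigzag_le {m : ℕ} (hm : 2 ≤ m) :
    frechetDist (polyCurve (zigzagA m)) (polyCurve (zigzagAbar m)) ≤ 1 / (2 * m) := by
  have hm' : (2 : ℝ) ≤ m := by exact_mod_cast hm
  have hpos : (0 : ℝ) < m - 1 := by linarith
  have hcast : ((2 * (m - 1) : ℕ) : ℝ) = 2 * (m - 1) := by
    push_cast [Nat.cast_sub (show 1 ≤ m by omega)]; ring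
  have hcastA : ((2 * m : ℕ) : ℝ) = 2 * m := by push_cast; ring
  refine frechetDist_le .id
    (reparam_min_mul (c := m / (m - 1)) ((one_le_div hpos).2 (by linarith))) fun t ht => ?_
  obtain ⟨k, hk, h₁, h₂⟩ := exists_edge_index (n := 2 * m) (by omega) ht
  rw [polyCurve_eq _ hk h₁ h₂, Real.norm_eq_abs]
  simp only [smul_eq_mul]
  by_cases hkm : k < 2 * (m - 1)
  · have hle : (k : ℝ) + 1 ≤ (2 * (m - 1) : ℕ) := by exact_mod_cast hkm
    have hmin : min (t * (m / (m - 1) : ℝ)) 1 = t * (m / (m - 1)) := by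
      refine min_eq_left ?_
      rw [← mul_div_assoc, div_le_one hpos]
      rw [hcast] at hle
      rw [hcastA] at h₂
      linarith
    have heq : t * (m / (m - 1) : ℝ) * (2 * (m - 1) : ℕ) = t * (2 * m : ℕ) := by
      rw [hcast, hcastA]; field_simp
    rw [hmin, polyCurve_eq _ hkm (heq ▸ h₁) (heq ▸ h₂), heq]
    exact abs_convexCombination_sub_le (by linarith) (by linarith)
      (abs_zigzagA_sub_zigzagAbar_le m k _) (abs_zigzagA_sub_zigzagAbar_le m (k + 1) _)
  · have hge : ((2 * (m - 1) : ℕ) : ℝ) ≤ k := by exact_mod_cast not_lt.1 hkm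
    have hmin : min (t * (m / (m - 1) : ℝ)) 1 = 1 := by
      refine min_eq_right ?_
      rw [← mul_div_assoc, one_le_div hpos]
      rw [hcast] at hge
      rw [hcastA] at h₁
      linarith
    have hend : polyCurve (zigzagAbar m) 1 = 1 / 2 := by
      have hk' : 2 * (m - 1) - 1 < 2 * (m - 1) := by omega
      have hc : ((2 * (m - 1) - 1 : ℕ) : ℝ) + 1 = (2 * (m - 1) : ℕ) := by
        exact_mod_cast (show 2 * (m - 1) - 1 + 1 = 2 * (m - 1) by omega)
      have hlast : 2 * (m - 1) - 1 + 1 = 2 * (m - 1) := by omega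
      rw [polyCurve_eq _ hk' (by linarith) (by linarith), ← hc]
      simp only [hlast, zigzagAbar_last hm]
      simp
    rw [hmin, hend]
    have := abs_convexCombination_sub_le (u := t * (2 * m : ℕ) - k) (by linarith) (by linarith)
      (abs_zigzagA_sub_half_le (m := m) (j := k) (by omega) (by omega) (by omega))
      (abs_zigzagA_sub_half_le (m := m) (j := k + 1) (by omega) (by omega) (by omega))
    rwa [show ∀ u : ℝ, (1 - u) * (1 / 2) + u * (1 / 2) = 1 / 2 by intro u; ring] at this

theorem le_frechetDist_zigzag_segment {δ : ℝ} (h0 : 0 ≤ δ) (h1 : δ ≤ 1) :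
    (1 - δ) / 2 ≤ frechetDist (polyCurve (n := 3) ![(0 : ℝ), 1, δ, 1 - δ])
      (polyCurve (n := 1) ![(0 : ℝ), 1 - δ]) := by
  have hconv := convex_closedBall (0 : ℝ) 1
  refine le_frechetDist (C := 1) (D := 1)
    (fun t ht => mem_closedBall_zero_iff.1 (polyCurve_mem_of_convex (by simp) hconv ?_ ht))
    (fun t ht => mem_closedBall_zero_iff.1 (polyCurve_mem_of_convex (by simp) hconv ?_ ht)) ?_
  · intro i
    rw [mem_closedBall_zero_iff, Real.norm_eq_abs, abs_le]
    fin_cases i <;> simp <;> constructor <;> linarith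
  · intro i
    rw [mem_closedBall_zero_iff, Real.norm_eq_abs, abs_le]
    fin_cases i <;> simp
    constructor <;> linarith
  intro φ ψ hφ hψ b hb
  obtain ⟨t₁, ht₁, hφ₁⟩ : (1 / 3 : ℝ) ∈ φ '' Icc 0 1 := by rw [hφ.2.2]; norm_num
  obtain ⟨t₂, ht₂, hφ₂⟩ : (2 / 3 : ℝ) ∈ φ '' Icc 0 1 := by rw [hφ.2.2]; norm_num
  have ht : t₁ ≤ t₂ := by
    by_contra! h
    have := hφ.2.1 ht₂ ht₁ h.le
    norm_num [hφ₁, hφ₂] at this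
  have hseg : ∀ t ∈ Icc (0 : ℝ) 1, polyCurve (n := 1) ![(0 : ℝ), 1 - δ] t = t * (1 - δ) := by
    intro t ht
    rw [polyCurve_eq (k := 0) _ one_pos (by simpa using ht.1) (by simpa using ht.2)]
    simp
  have hB₁ : polyCurve (n := 3) ![(0 : ℝ), 1, δ, 1 - δ] (1 / 3) = 1 := by
    rw [polyCurve_eq (k := 1) _ (by norm_num) (by norm_num) (by norm_num)]
    simp
  have hB₂ : polyCurve (n := 3) ![(0 : ℝ), 1, δ, 1 - δ] (2 / 3) = δ := by
    rw [polyCurve_eq (k := 2) _ (by norm_num) (by norm_num) (by norm_num)]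
    norm_num
  have hb₁ := hb t₁ ht₁
  have hb₂ := hb t₂ ht₂
  rw [hφ₁, hB₁, hseg _ (hψ.mem_Icc ht₁), Real.norm_eq_abs] at hb₁
  rw [hφ₂, hB₂, hseg _ (hψ.mem_Icc ht₂), Real.norm_eq_abs] at hb₂
  have hle := mul_le_mul_of_nonneg_right (hψ.2.1 ht₁ ht₂ ht) (sub_nonneg.2 h1)
  linarith [(abs_le.1 hb₁).2, (abs_le.1 hb₂).1]

/-- For the zig-zag curves `A` and `Ā` above (`δ = 1/(2m)`),
`d_F(A, Ā) ≤ 2δ`, yet the edgewise matching of the first edge `e = [0, 1−δ]` of `Ā` to its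
corresponding subcurve `B = 0,1,δ,1−δ` of `A` has Fréchet distance at least `(1−δ)/2`. -/
theorem greedy_edgewise_simplification_bad (m : ℕ) (hm : 2 ≤ m) :
    frechetDist (polyCurve (zigzagA m)) (polyCurve (zigzagAbar m)) ≤ 2 * (1 / (2 * m) : ℝ) ∧
    (1 - 1 / (2 * m) : ℝ) / 2 ≤
      frechetDist (polyCurve (n := 3) ![(0 : ℝ), 1, 1 / (2 * m), 1 - 1 / (2 * m)])
        (polyCurve (n := 1) ![(0 : ℝ), 1 - 1 / (2 * m)]) := by
  have hm' : (2 : ℝ) ≤ m := by exact_mod_cast hm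
  have hδ : (0 : ℝ) ≤ 1 / (2 * m) := by positivity
  refine ⟨(frechetDist_zigzag_le hm).trans (by linarith), le_frechetDist_zigzag_segment hδ ?_⟩
  rw [div_le_one (by positivity)]
  linarith
end
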